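/- Let n ∈ ℕ, a₀, b₀ > 0, and T ≥ 0, and define L(a) = n·a·log(a) − n·log Γ(a) − (T+n)·a + (a₀−1)·log(a) − b₀·a for a > 0, with d₁(a) = L′(a) and d₂(a) = L″(a). Then there exists a > 0 such that a·d₂(a) + d₁(a) ≠ 0 and a = (a²·d₂(a) − 1)/(a·d₂(a) + d₁(a)); that is, the iteration map of Algorithm 1 has a fixed point. -/

import Mathlib

open Filter Topology Set

lemma Real.analyticAt_log_Gamma {x : ℝ} (hx : 0 < x) :
    AnalyticAt ℝ (fun y => Real.log (Real.Gamma y)) x := by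
  have hC : AnalyticAt ℂ Complex.Gamma (x : ℂ) := by
    rw [Complex.analyticAt_iff_eventually_differentiableAt]
    have hopen : IsOpen {z : ℂ | 0 < z.re} := isOpen_lt continuous_const Complex.continuous_re
    filter_upwards [hopen.mem_nhds (show 0 < (x : ℂ).re by simpa using hx)] with z hz
    refine Complex.differentiableAt_Gamma z fun m hm => ?_
    have hre : z.re = -(m : ℝ) := by simp [hm]
    have hm0 : (0 : ℝ) ≤ m := m.cast_nonneg
    have hz' : 0 < z.re := hz
    linarith
  have hR : AnalyticAt ℝ Real.Gamma x :=
    (hC.contDiffAt (n := ⊤)).real_of_complex.analyticAt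
  exact hR.log (Real.Gamma_pos_of_pos hx)

lemma Real.differentiableAt_log_Gamma {x : ℝ} (hx : 0 < x) :
    DifferentiableAt ℝ (fun y => Real.log (Real.Gamma y)) x :=
  (Real.analyticAt_log_Gamma hx).differentiableAt

lemma Real.differentiableAt_deriv_log_Gamma {x : ℝ} (hx : 0 < x) :
    DifferentiableAt ℝ (deriv fun y => Real.log (Real.Gamma y)) x :=
  (Real.analyticAt_log_Gamma hx).deriv.differentiableAt

lemma Real.log_Gamma_add_one {x : ℝ} (hx : 0 < x) :
    Real.log (Real.Gamma (x + 1)) = Real.log (Real.Gamma x) + Real.log x := by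
  rw [Real.Gamma_add_one hx.ne', Real.log_mul hx.ne' (Real.Gamma_pos_of_pos hx).ne', add_comm]

lemma Real.deriv_log_Gamma_add_one {x : ℝ} (hx : 0 < x) :
    deriv (fun y => Real.log (Real.Gamma y)) (x + 1) =
      deriv (fun y => Real.log (Real.Gamma y)) x + x⁻¹ := by
  rw [← deriv_comp_add_const, ← Real.deriv_log,
    ← deriv_fun_add (Real.differentiableAt_log_Gamma hx) (Real.differentiableAt_log hx.ne')]
  apply EventuallyEq.deriv_eq
  filter_upwards [eventually_gt_nhds hx] with y hy using Real.log_Gamma_add_one hy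

lemma Real.deriv_deriv_log_Gamma_add_one {x : ℝ} (hx : 0 < x) :
    deriv (deriv fun y => Real.log (Real.Gamma y)) (x + 1) =
      deriv (deriv fun y => Real.log (Real.Gamma y)) x - (x ^ 2)⁻¹ := by
  have hinv : deriv (fun y : ℝ => y⁻¹) x = -(x ^ 2)⁻¹ := deriv_inv
  rw [← deriv_comp_add_const, sub_eq_add_neg, ← hinv,
    ← deriv_fun_add (Real.differentiableAt_deriv_log_Gamma hx) (differentiableAt_inv hx.ne')]
  apply EventuallyEq.deriv_eq
  filter_upwards [eventually_gt_nhds hx] with y hy using Real.deriv_log_Gamma_add_one hy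

lemma Real.deriv_log_Gamma_le_log {x : ℝ} (hx : 0 < x) :
    deriv (fun y => Real.log (Real.Gamma y)) x ≤ Real.log x := by
  have hc : ConvexOn ℝ (Ioi 0) fun y => Real.log (Real.Gamma y) := Real.convexOn_log_Gamma
  have h := hc.deriv_le_slope (mem_Ioi.2 hx) (mem_Ioi.2 (by linarith : (0 : ℝ) < x + 1))
    (by linarith) (Real.differentiableAt_log_Gamma hx)
  rwa [slope_def_field, Real.log_Gamma_add_one hx, add_sub_cancel_left, add_sub_cancel_left,
    div_one] at h

lemma Real.log_sub_deriv_log_Gamma_le_inv {x : ℝ} (hx : 0 < x) :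
    Real.log x - deriv (fun y => Real.log (Real.Gamma y)) x ≤ x⁻¹ := by
  have hc : ConvexOn ℝ (Ioi 0) fun y => Real.log (Real.Gamma y) := Real.convexOn_log_Gamma
  have hx1 : 0 < x + 1 := by linarith
  have h := hc.slope_le_deriv (mem_Ioi.2 hx) (mem_Ioi.2 hx1)
    (by linarith) (Real.differentiableAt_log_Gamma hx1)
  rw [slope_def_field, Real.log_Gamma_add_one hx, add_sub_cancel_left, add_sub_cancel_left,
    div_one, Real.deriv_log_Gamma_add_one hx] at h
  linarith

lemma Real.deriv_deriv_log_Gamma_nonneg {x : ℝ} (hx : 0 < x) :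
    0 ≤ deriv (deriv fun y => Real.log (Real.Gamma y)) x := by
  have hc : ConvexOn ℝ (Ioi 0) fun y => Real.log (Real.Gamma y) := Real.convexOn_log_Gamma
  have hm := hc.monotoneOn_deriv fun y hy => Real.differentiableAt_log_Gamma hy
  have h := hm.derivWithin_nonneg (x := x)
  rwa [derivWithin_of_isOpen isOpen_Ioi hx] at h

/-- A function on `[1, ∞)` that does not decrease under unit shifts and is bounded above by
`C / x` is nonpositive. -/
lemma nonpos_of_le_add_one_of_le_div {F : ℝ → ℝ} {C : ℝ}
    (hstep : ∀ x, 1 ≤ x → F x ≤ F (x + 1)) (hbound : ∀ x, 1 ≤ x → F x ≤ C / x)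
    {x : ℝ} (hx : 1 ≤ x) : F x ≤ 0 := by
  have hshift : ∀ m : ℕ, F x ≤ F (x + m) := by
    intro m
    induction m with
    | zero => simp
    | succ m ih =>
      refine ih.trans ((hstep _ (by linarith [m.cast_nonneg (α := ℝ)])).trans_eq ?_)
      push_cast
      rw [add_assoc]
  have hlim : Tendsto (fun m : ℕ => C / (x + m)) atTop (𝓝 0) :=
    tendsto_const_nhds.div_atTop
      (tendsto_atTop_add_const_left _ _ tendsto_natCast_atTop_atTop)
  exact ge_of_tendsto' hlim fun m =>
    (hshift m).trans (hbound _ (by linarith [m.cast_nonneg (α := ℝ)]))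

lemma Real.log_sub_deriv_log_Gamma_le {x : ℝ} (hx : 1 ≤ x) :
    Real.log x - deriv (fun y => Real.log (Real.Gamma y)) x ≤ 1 / (2 * x) + 1 / (8 * x ^ 2) := by
  have key := nonpos_of_le_add_one_of_le_div (C := 1)
    (F := fun y => Real.log y - deriv (fun y => Real.log (Real.Gamma y)) y
      - (1 / (2 * y) + 1 / (8 * y ^ 2))) ?_ ?_ hx
  · linarith
  · intro y hy
    have hy0 : 0 < y := by linarith
    have hlog : 2 / (2 * y + 1) ≤ Real.log (y + 1) - Real.log y := by
      have h := Real.le_log_one_add_of_nonneg (x := y⁻¹) (by positivity)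
      rw [← Real.log_div (by positivity) hy0.ne']
      convert! h using 1
      · field_simp
        ring
      · congr 1
        field_simp
    have hrat : y⁻¹ - 2 / (2 * y + 1) ≤ (1 / (2 * y) + 1 / (8 * y ^ 2))
        - (1 / (2 * (y + 1)) + 1 / (8 * (y + 1) ^ 2)) := by
      rw [← sub_nonneg]
      have : (1 / (2 * y) + 1 / (8 * y ^ 2)) - (1 / (2 * (y + 1)) + 1 / (8 * (y + 1) ^ 2))
          - (y⁻¹ - 2 / (2 * y + 1)) = 1 / (8 * y ^ 2 * (y + 1) ^ 2 * (2 * y + 1)) := by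
        field_simp
        ring
      rw [this]
      positivity
    simp only [Real.deriv_log_Gamma_add_one hy0]
    linarith
  · intro y hy
    have hy0 : 0 < y := by linarith
    have h := Real.log_sub_deriv_log_Gamma_le_inv hy0
    have hp : 0 ≤ 1 / (2 * y) + 1 / (8 * y ^ 2) := by positivity
    rw [one_div y]
    linarith

lemma Real.le_deriv_deriv_log_Gamma {x : ℝ} (hx : 1 ≤ x) :
    1 / x + 1 / (2 * x ^ 2) + 1 / (8 * x ^ 3) ≤
      deriv (deriv fun y => Real.log (Real.Gamma y)) x := by
  have key := nonpos_of_le_add_one_of_le_div (C := 2)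
    (F := fun y => 1 / y + 1 / (2 * y ^ 2) + 1 / (8 * y ^ 3)
      - deriv (deriv fun y => Real.log (Real.Gamma y)) y) ?_ ?_ hx
  · linarith
  · intro y hy
    have hy0 : 0 < y := by linarith
    have hrat : (1 / y + 1 / (2 * y ^ 2) + 1 / (8 * y ^ 3))
        - (1 / (y + 1) + 1 / (2 * (y + 1) ^ 2) + 1 / (8 * (y + 1) ^ 3)) ≤ (y ^ 2)⁻¹ := by
      rw [← sub_nonneg]
      have : (y ^ 2)⁻¹ - ((1 / y + 1 / (2 * y ^ 2) + 1 / (8 * y ^ 3))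
          - (1 / (y + 1) + 1 / (2 * (y + 1) ^ 2) + 1 / (8 * (y + 1) ^ 3)))
          = (y ^ 2 + y - 1) / (8 * y ^ 3 * (y + 1) ^ 3) := by
        field_simp
        ring
      rw [this]
      exact div_nonneg (by nlinarith) (by positivity)
    simp only [Real.deriv_deriv_log_Gamma_add_one hy0]
    linarith
  · intro y hy
    have hy0 : 0 < y := by linarith
    have h := Real.deriv_deriv_log_Gamma_nonneg hy0
    have hrat : 1 / y + 1 / (2 * y ^ 2) + 1 / (8 * y ^ 3) ≤ 2 / y := by
      rw [← sub_nonneg]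
      have : 2 / y - (1 / y + 1 / (2 * y ^ 2) + 1 / (8 * y ^ 3))
          = (8 * y ^ 2 - 4 * y - 1) / (8 * y ^ 3) := by
        field_simp
        ring
      rw [this]
      exact div_nonneg (by nlinarith) (by positivity)
    linarith

lemma Real.le_log_add_one_sub_log {a : ℝ} (ha : 0 < a) :
    1 / (a + 1) + 1 / (2 * (a + 1) ^ 2) + 1 / (3 * (a + 1) ^ 3) ≤
      Real.log (a + 1) - Real.log a := by
  have hu : |1 / (a + 1)| < 1 := by
    rw [abs_of_pos (by positivity), div_lt_one (by linarith)]
    linarith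
  have h := sum_le_hasSum (Finset.range 3) (fun i _ => by positivity)
    (Real.hasSum_pow_div_log_of_abs_lt_one hu)
  have heq : (1 : ℝ) - 1 / (a + 1) = a / (a + 1) := by
    field_simp
    ring
  rw [heq, Real.log_div ha.ne' (by linarith)] at h
  simp only [Finset.sum_range_succ, Finset.sum_range_zero] at h
  push_cast at h
  calc _ = _ := by
        field_simp
        ring
    _ ≤ _ := h
    _ = _ := by ring

/-- The derivative of `a ↦ a * (log a - ψ a)`, with `ψ` the logarithmic derivative of `Γ`, is
nonpositive on the positive reals. -/
lemma Real.log_sub_deriv_log_Gamma_add_one_le {a : ℝ} (ha : 0 < a) :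
    Real.log a - deriv (fun y => Real.log (Real.Gamma y)) a + 1
      ≤ a * deriv (deriv fun y => Real.log (Real.Gamma y)) a := by
  have hw := Real.log_sub_deriv_log_Gamma_le (x := a + 1) (by linarith)
  have hr := Real.le_deriv_deriv_log_Gamma (x := a + 1) (by linarith)
  rw [Real.deriv_log_Gamma_add_one ha] at hw
  rw [Real.deriv_deriv_log_Gamma_add_one ha] at hr
  have hlog := Real.le_log_add_one_sub_log ha
  have hr' := mul_le_mul_of_nonneg_left hr ha.le
  have hrat : a⁻¹ + (1 / (2 * (a + 1)) + 1 / (8 * (a + 1) ^ 2))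
      - (1 / (a + 1) + 1 / (2 * (a + 1) ^ 2) + 1 / (3 * (a + 1) ^ 3)) + 1
      ≤ a * (1 / (a + 1) + 1 / (2 * (a + 1) ^ 2) + 1 / (8 * (a + 1) ^ 3)) + a * (a ^ 2)⁻¹ := by
    rw [← sub_nonneg]
    have : a * (1 / (a + 1) + 1 / (2 * (a + 1) ^ 2) + 1 / (8 * (a + 1) ^ 3)) + a * (a ^ 2)⁻¹
        - (a⁻¹ + (1 / (2 * (a + 1)) + 1 / (8 * (a + 1) ^ 2))
          - (1 / (a + 1) + 1 / (2 * (a + 1) ^ 2) + 1 / (3 * (a + 1) ^ 3)) + 1)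
        = 5 / (24 * (a + 1) ^ 3) := by
      field_simp
      ring
    rw [this]
    positivity
  linarith

/-- With L(a) = n·a·log a − n·log Γ(a) − (T+n)·a + (a₀−1)·log a − b₀·a, d₁ = L′,
    d₂ = L″, and T ≥ 0: the iteration map a ↦ (a²·d₂(a) − 1)/(a·d₂(a) + d₁(a))
    of Algorithm 1 has a fixed point a > 0. -/
theorem gamma_shape_exists_fixed_point (n : ℕ) (a0 b0 : ℝ)
    (ha0 : 0 < a0) (hb0 : 0 < b0) (T : ℝ) (hT : 0 ≤ T)
    (L : ℝ → ℝ)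
    (hL : L = fun a : ℝ => n * a * Real.log a - n * Real.log (Real.Gamma a)
      - (T + n) * a + (a0 - 1) * Real.log a - b0 * a)
    (d1 d2 : ℝ → ℝ) (hd1 : d1 = deriv L) (hd2 : d2 = deriv (deriv L)) :
    ∃ a : ℝ, 0 < a ∧ a * d2 a + d1 a ≠ 0 ∧
      a = (a ^ 2 * d2 a - 1) / (a * d2 a + d1 a) := by
  set ψ := deriv fun y => Real.log (Real.Gamma y)
  have hd1' : ∀ a, 0 < a → d1 a =
      n * (Real.log a + 1) - n * ψ a - (T + n) + (a0 - 1) * a⁻¹ - b0 := by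
    intro a ha
    have hlog := Real.hasDerivAt_log ha.ne'
    have hΓ : HasDerivAt (fun y => Real.log (Real.Gamma y)) (ψ a) a :=
      (Real.differentiableAt_log_Gamma ha).hasDerivAt
    rw [hd1, hL]
    refine HasDerivAt.deriv ?_
    refine ((((((((hasDerivAt_id a).const_mul (n : ℝ)).mul hlog).sub (hΓ.const_mul (n : ℝ))).sub
      ((hasDerivAt_id a).const_mul (T + n))).add (hlog.const_mul (a0 - 1))).sub
      ((hasDerivAt_id a).const_mul b0))).congr_deriv ?_
    simp only [id]
    field_simp
  have hd2' : ∀ a, 0 < a → d2 a = n * a⁻¹ - n * deriv ψ a - (a0 - 1) * (a ^ 2)⁻¹ := by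
    intro a ha
    have hψ' : HasDerivAt ψ (deriv ψ a) a :=
      (Real.differentiableAt_deriv_log_Gamma ha).hasDerivAt
    have hev : deriv L =ᶠ[𝓝 a] fun a =>
        n * (Real.log a + 1) - n * ψ a - (T + n) + (a0 - 1) * a⁻¹ - b0 := by
      filter_upwards [eventually_gt_nhds ha] with y hy
      rw [← hd1, hd1' y hy]
    rw [hd2, hev.deriv_eq]
    refine HasDerivAt.deriv ?_
    refine (((((((Real.hasDerivAt_log ha.ne').add_const 1).const_mul (n : ℝ)).sub
      (hψ'.const_mul (n : ℝ))).sub_const (T + n)).add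
      ((hasDerivAt_inv ha.ne').const_mul (a0 - 1))).sub_const b0).congr_deriv ?_
    ring
  have hg : ∀ a, 0 < a → a * d1 a =
      n * (a * (Real.log a - ψ a)) - (T + b0) * a + (a0 - 1) := by
    intro a ha
    rw [hd1' a ha]
    field_simp
    ring
  have hn : (0 : ℝ) ≤ n := n.cast_nonneg
  have hcont : ContinuousOn (fun a => a * d1 a) (Ioi 0) := by
    have hc : ContinuousOn
        (fun a => n * (a * (Real.log a - ψ a)) - (T + b0) * a + (a0 - 1)) (Ioi 0) := by
      intro a ha
      have hψc : ContinuousAt ψ a := (Real.differentiableAt_deriv_log_Gamma ha).continuousAt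
      have hlc : ContinuousAt Real.log a := Real.continuousAt_log (ne_of_gt ha)
      refine ContinuousAt.continuousWithinAt ?_
      fun_prop
    exact hc.congr fun a ha => hg a ha
  have hTb : 0 < T + b0 := by linarith
  have hsmall : -1 ≤ a0 / (T + b0) * d1 (a0 / (T + b0)) := by
    have hp : 0 < a0 / (T + b0) := by positivity
    rw [hg _ hp, mul_div_cancel₀ _ hTb.ne']
    have := mul_nonneg hn (mul_nonneg hp.le (sub_nonneg.2 (Real.deriv_log_Gamma_le_log hp)))
    linarith
  have hlarge : (n + a0) / (T + b0) * d1 ((n + a0) / (T + b0)) ≤ -1 := by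
    have hp : 0 < (n + a0) / (T + b0) := by positivity
    rw [hg _ hp, mul_div_cancel₀ _ hTb.ne']
    have h1 := mul_le_mul_of_nonneg_left (Real.log_sub_deriv_log_Gamma_le_inv hp) hp.le
    rw [mul_inv_cancel₀ hp.ne'] at h1
    have := mul_le_mul_of_nonneg_left h1 hn
    linarith
  have hle : a0 / (T + b0) ≤ (n + a0) / (T + b0) := by gcongr; linarith
  have hpos : ∀ a ∈ Icc (a0 / (T + b0)) ((n + a0) / (T + b0)), 0 < a := fun a ha =>
    lt_of_lt_of_le (by positivity) ha.1
  obtain ⟨a, ha, hroot⟩ := intermediate_value_Icc' hle (hcont.mono hpos) ⟨hlarge, hsmall⟩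
  have ha0' := hpos a ha
  have hne : a * d2 a + d1 a < 0 := by
    have h := mul_le_mul_of_nonneg_left (Real.log_sub_deriv_log_Gamma_add_one_le ha0') hn
    have heq : a * d2 a + d1 a =
        n * (Real.log a - ψ a + 1) - n * (a * deriv ψ a) - (T + b0) := by
      rw [hd1' a ha0', hd2' a ha0']
      field_simp
      ring
    rw [heq]
    linarith
  refine ⟨a, ha0', hne.ne, ?_⟩
  have hroot' : a * d1 a = -1 := hroot
  rw [eq_div_iff hne.ne]
  linear_combination hroot'
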